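/- Lemma 3.7. Suppose b₁,b₂≥0 and conditions (V), (F_0), (F_1), (C_1) hold. Then for every sufficiently large k there exist constants ρ>0 and α>0 such that Φ(u,v) ≥ α for all (u,v)∈Z_k with ‖(u,v)‖=ρ. -/

import Mathlib

open Filter Topology

/-- A connected, locally finite weighted graph `G = (V, E)` with symmetric positive edge
weights `w` (vanishing off edges) and a vertex measure `mu` with positive lower bound
`mumin`. -/
structure WeightedGraph (V : Type*) where
  G : SimpleGraph V
  connected : G.Connected
  locallyFinite : ∀ x : V, (G.neighborSet x).Finite
  w : V → V → ℝ
  w_symm : ∀ x y, w x y = w y x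
  w_pos : ∀ x y, G.Adj x y → 0 < w x y
  w_eq_zero : ∀ x y, ¬ G.Adj x y → w x y = 0
  mu : V → ℝ
  mumin : ℝ
  mumin_pos : 0 < mumin
  mu_ge : ∀ x, mumin ≤ mu x

namespace WeightedGraph

variable {V : Type*} (S : WeightedGraph V)

/-- `∫_V φ dμ = Σ_{x ∈ V} φ(x) μ(x)`. -/
noncomputable def integral (φ : V → ℝ) : ℝ := ∑' x, φ x * S.mu x

/-- The graph Laplacian `Δu(x) = (1/μ(x)) Σ_{y ∼ x} w_{xy} (u(y) - u(x))`. -/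
noncomputable def lap (u : V → ℝ) (x : V) : ℝ :=
  (1 / S.mu x) * ∑' y, S.w x y * (u y - u x)

/-- `|∇u|²(x) = (1/(2μ(x))) Σ_{y ∼ x} w_{xy} (u(y) - u(x))²`. -/
noncomputable def gradSq (u : V → ℝ) (x : V) : ℝ :=
  (1 / (2 * S.mu x)) * ∑' y, S.w x y * (u y - u x) ^ 2

/-- `∇u·∇v(x) = (1/(2μ(x))) Σ_{y ∼ x} w_{xy} (u(y) - u(x))(v(y) - v(x))`. -/
noncomputable def gradDot (u v : V → ℝ) (x : V) : ℝ :=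
  (1 / (2 * S.mu x)) * ∑' y, S.w x y * (u y - u x) * (v y - v x)

/-- The `L^r` norm `‖u‖_r = (∫_V |u|^r dμ)^{1/r}` for `1 ≤ r < ∞`. -/
noncomputable def normLr (r : ℝ) (u : V → ℝ) : ℝ :=
  (S.integral fun x => |u x| ^ r) ^ (1 / r)

/-- The density `|Δu|² + a |∇u|² + V(x) u²` defining the norm of the space `E_i`. -/
noncomputable def energyDensity (a : ℝ) (Vp : V → ℝ) (u : V → ℝ) (x : V) : ℝ :=
  (S.lap u x) ^ 2 + a * S.gradSq u x + Vp x * (u x) ^ 2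

/-- Membership in the working space `E_i` (finiteness of the `E_i`-norm). -/
def memE (a : ℝ) (Vp : V → ℝ) (u : V → ℝ) : Prop :=
  Summable fun x => S.energyDensity a Vp u x * S.mu x

/-- The norm `‖u‖_{E_i} = (∫_V (|Δu|² + a_i |∇u|² + V_i(x)u²) dμ)^{1/2}`. -/
noncomputable def normE (a : ℝ) (Vp : V → ℝ) (u : V → ℝ) : ℝ :=
  Real.sqrt (S.integral (S.energyDensity a Vp u))

/-- The inner product `(u,v)_{E_i} = ∫_V (Δu Δv + a_i ∇u·∇v + V_i(x) u v) dμ`. -/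
noncomputable def innerE (a : ℝ) (Vp : V → ℝ) (u v : V → ℝ) : ℝ :=
  S.integral fun x => S.lap u x * S.lap v x + a * S.gradDot u v x + Vp x * u x * v x

/-- The energy functional `Φ` of the biharmonic–Kirchhoff system. -/
noncomputable def Phi (a₁ a₂ b₁ b₂ : ℝ) (V₁ V₂ : V → ℝ) (F : V → ℝ → ℝ → ℝ)
    (u v : V → ℝ) : ℝ :=
  (1/2) * S.integral (S.energyDensity a₁ V₁ u) + (1/2) * S.integral (S.energyDensity a₂ V₂ v)
    + (b₁/4) * (S.integral (S.gradSq u)) ^ 2 + (b₂/4) * (S.integral (S.gradSq v)) ^ 2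
    - S.integral fun x => F x (u x) (v x)

/-- The action `⟨Φ'(u,v), (φ₁,φ₂)⟩` of the derivative of `Φ`. -/
noncomputable def PhiDeriv (a₁ a₂ b₁ b₂ : ℝ) (V₁ V₂ : V → ℝ) (Fs Ft : V → ℝ → ℝ → ℝ)
    (u v φ₁ φ₂ : V → ℝ) : ℝ :=
  S.innerE a₁ V₁ u φ₁ + S.innerE a₂ V₂ v φ₂
    + b₁ * S.integral (S.gradSq u) * S.integral (S.gradDot u φ₁)
    + b₂ * S.integral (S.gradSq v) * S.integral (S.gradDot v φ₂)
    - S.integral (fun x => Fs x (u x) (v x) * φ₁ x)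
    - S.integral (fun x => Ft x (u x) (v x) * φ₂ x)

/-- `(u,v)` solves the biharmonic–Kirchhoff system (pointwise on `V`). -/
def IsSolution (a₁ a₂ b₁ b₂ : ℝ) (V₁ V₂ : V → ℝ) (Fs Ft : V → ℝ → ℝ → ℝ)
    (u v : V → ℝ) : Prop :=
  (∀ x, S.lap (S.lap u) x - (a₁ + b₁ * S.integral (S.gradSq u)) * S.lap u x + V₁ x * u x
      = Fs x (u x) (v x)) ∧
  (∀ x, S.lap (S.lap v) x - (a₂ + b₂ * S.integral (S.gradSq v)) * S.lap v x + V₂ x * v x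
      = Ft x (u x) (v x))

/-- Condition (V): `θᵢ = inf_V Vᵢ > 0` and `Vᵢ(x) → +∞` as `d(x,x₀) → ∞`. -/
def CondV (V₁ V₂ : V → ℝ) (θ₁ θ₂ : ℝ) : Prop :=
  IsGLB (Set.range V₁) θ₁ ∧ IsGLB (Set.range V₂) θ₂ ∧ 0 < θ₁ ∧ 0 < θ₂ ∧
    ∃ x₀ : V, ∀ M : ℝ, ∃ N : ℕ, ∀ x : V, N ≤ S.G.dist x₀ x → M ≤ V₁ x ∧ M ≤ V₂ x

/-- Condition (F₀). -/
def CondF0 (F : V → ℝ → ℝ → ℝ) : Prop :=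
  (∀ x, F x 0 0 = 0) ∧ ∀ x, ContDiff ℝ 1 (fun p : ℝ × ℝ => F x p.1 p.2)

/-- `Fs` and `Ft` are the partial derivatives of `F` in its last two arguments. -/
def IsPartialDerivs (F Fs Ft : V → ℝ → ℝ → ℝ) : Prop :=
  ∀ x s t, HasDerivAt (fun s' => F x s' t) (Fs x s t) s ∧
           HasDerivAt (fun t' => F x s t') (Ft x s t) t

/-- Condition (F₁). -/
def CondF1 (F Fs Ft : V → ℝ → ℝ → ℝ) (a : ℝ → ℝ) (b : V → ℝ) : Prop :=
  ContinuousOn a (Set.Ici 0) ∧ (∀ r : ℝ, 0 ≤ r → 0 ≤ a r) ∧ (∀ x, 0 < b x) ∧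
    Summable (fun x => b x * S.mu x) ∧
    ∀ x s t, |Fs x s t| ≤ a (Real.sqrt (s ^ 2 + t ^ 2)) * b x ∧
             |Ft x s t| ≤ a (Real.sqrt (s ^ 2 + t ^ 2)) * b x ∧
             |F x s t| ≤ a (Real.sqrt (s ^ 2 + t ^ 2)) * b x

/-- Condition (C₁): `lim_{r → 0⁺} a(r)/r² = h < ∞`. -/
def CondC1 (a : ℝ → ℝ) : Prop :=
  ∃ h : ℝ, Tendsto (fun r => a r / r ^ 2) (nhdsWithin 0 (Set.Ioi 0)) (nhds h)

/-- `γ_{∞,i} = (μ_min · inf_V V_i)^{-1/2}`. -/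
noncomputable def gammaInf (θ : ℝ) : ℝ := 1 / Real.sqrt (S.mumin * θ)

/-- Condition (C₂). -/
def CondC2 (a : ℝ → ℝ) (b : V → ℝ) (θ₁ θ₂ : ℝ) : Prop :=
  ∃ ρ : ℝ, 0 < ρ ∧
    0 < ρ ^ 2 / 4 - sSup (a '' Set.Icc 0 ((S.gammaInf θ₁ + S.gammaInf θ₂) * ρ)) * S.integral b

/-- Condition (F₂): `F(x,s,t)/|(s,t)|⁴ → +∞` as `|(s,t)| → ∞`, uniformly in `x`. -/
def CondF2 (F : V → ℝ → ℝ → ℝ) : Prop :=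
  ∀ M : ℝ, ∃ R : ℝ, ∀ x s t, R ≤ Real.sqrt (s ^ 2 + t ^ 2) → M * (s ^ 2 + t ^ 2) ^ 2 ≤ F x s t

/-- Condition (F₂)': `F(x,s,t)/|(s,t)|² → +∞` as `|(s,t)| → ∞`, uniformly in `x`. -/
def CondF2' (F : V → ℝ → ℝ → ℝ) : Prop :=
  ∀ M : ℝ, ∃ R : ℝ, ∀ x s t, R ≤ Real.sqrt (s ^ 2 + t ^ 2) → M * (s ^ 2 + t ^ 2) ≤ F x s t

/-- Condition (F₃): `F ≥ 0` outside the ball of radius `r₀`. -/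
def CondF3 (F : V → ℝ → ℝ → ℝ) (r₀ : ℝ) : Prop :=
  ∀ x s t, r₀ ≤ Real.sqrt (s ^ 2 + t ^ 2) → 0 ≤ F x s t

/-- `𝓕(x,s,t) = λ (s F_s + t F_t) - F` (with `λ = 1/4` resp. `1/2`). -/
noncomputable def curlyF (lam : ℝ) (F Fs Ft : V → ℝ → ℝ → ℝ) (x : V) (s t : ℝ) : ℝ :=
  lam * (s * Fs x s t + t * Ft x s t) - F x s t

/-- Condition (F₄) (with `λ = 1/4`); `k` is a real exponent and `^` is `Real.rpow`. -/
def CondF4 (F Fs Ft : V → ℝ → ℝ → ℝ) (r₀ : ℝ) : Prop :=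
  (∀ (x : V) (s t : ℝ), 0 ≤ curlyF (1/4) F Fs Ft x s t) ∧
  ∃ c : ℝ, 0 < c ∧ ∃ k : ℝ, 1 < k ∧ ∀ (x : V) (s t : ℝ), r₀ ≤ Real.sqrt (s ^ 2 + t ^ 2) →
    |F x s t| ^ k ≤ c * (s ^ 2 + t ^ 2) ^ k * curlyF (1/4) F Fs Ft x s t

/-- Condition (F₄)' (with `λ = 1/2`). -/
def CondF4' (F Fs Ft : V → ℝ → ℝ → ℝ) (r₀ : ℝ) : Prop :=
  (∀ (x : V) (s t : ℝ), 0 ≤ curlyF (1/2) F Fs Ft x s t) ∧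
  ∃ c : ℝ, 0 < c ∧ ∃ k : ℝ, 1 < k ∧ ∀ (x : V) (s t : ℝ), r₀ ≤ Real.sqrt (s ^ 2 + t ^ 2) →
    |F x s t| ^ k ≤ c * (s ^ 2 + t ^ 2) ^ k * curlyF (1/2) F Fs Ft x s t

/-- `γ_{2,i} = (inf_V V_i)^{-1/2}`. -/
noncomputable def gamma2 (θ : ℝ) : ℝ := 1 / Real.sqrt θ

/-- Condition (F₅) (`lb = 4`), resp. (F₅)' (`lb = 2`): there are `μ̄ > lb` and an admissible
`σ` with `μ̄ F ≤ s F_s + t F_t + σ (s² + t²)`. -/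
def CondF5 (lb : ℝ) (F Fs Ft : V → ℝ → ℝ → ℝ) (θ₁ θ₂ : ℝ) : Prop :=
  ∃ μb : ℝ, lb < μb ∧ ∃ σ : ℝ, 0 < σ ∧
    σ < (μb - 2) / (2 * max (gamma2 θ₁ ^ 2) (gamma2 θ₂ ^ 2)) ∧
    ∀ (x : V) (s t : ℝ), μb * F x s t ≤ s * Fs x s t + t * Ft x s t + σ * (s ^ 2 + t ^ 2)

/-- Condition (F₆): `F` is even in `(s,t)`. -/
def CondF6 (F : V → ℝ → ℝ → ℝ) : Prop :=
  ∀ (x : V) (s t : ℝ), F x (-s) (-t) = F x s t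

/-- A Cerami sequence for `Φ`: `Φ(uₙ,vₙ)` is bounded and
`(1 + ‖(uₙ,vₙ)‖)‖Φ'(uₙ,vₙ)‖_{E*} → 0`. -/
def CeramiSeq (a₁ a₂ b₁ b₂ : ℝ) (V₁ V₂ : V → ℝ) (F Fs Ft : V → ℝ → ℝ → ℝ)
    (u v : ℕ → V → ℝ) : Prop :=
  (∀ n, S.memE a₁ V₁ (u n) ∧ S.memE a₂ V₂ (v n)) ∧
  (∃ C : ℝ, ∀ n, |S.Phi a₁ a₂ b₁ b₂ V₁ V₂ F (u n) (v n)| ≤ C) ∧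
  ∃ ε : ℕ → ℝ, Tendsto ε atTop (nhds 0) ∧
    ∀ (n : ℕ) (φ₁ φ₂ : V → ℝ), S.memE a₁ V₁ φ₁ → S.memE a₂ V₂ φ₂ →
      S.normE a₁ V₁ φ₁ + S.normE a₂ V₂ φ₂ ≤ 1 →
      (1 + (S.normE a₁ V₁ (u n) + S.normE a₂ V₂ (v n))) *
        |S.PhiDeriv a₁ a₂ b₁ b₂ V₁ V₂ Fs Ft (u n) (v n) φ₁ φ₂| ≤ ε n

end WeightedGraph

open WeightedGraph

namespace WeightedGraph

open scoped RealInnerProductSpace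

/-- A functional on a Hilbert space with complete orthonormal sequence `v` has small norm on the
orthogonal complement of the first `k` vectors, as `k → ∞`. -/
lemma exists_tail_bound {H : Type*} [NormedAddCommGroup H] [InnerProductSpace ℝ H]
    [CompleteSpace H] {v : ℕ → H} (hv : Orthonormal ℝ v)
    (htot : ∀ x : H, (∀ j, ⟪x, v j⟫ = 0) → x = 0) (L : H →L[ℝ] ℝ) :
    ∃ β : ℕ → ℝ, Tendsto β atTop (𝓝 0) ∧
      ∀ k x, (∀ j < k, ⟪x, v j⟫ = 0) → |L x| ≤ β k * ‖x‖ := by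
  obtain ⟨z, rfl⟩ := (InnerProductSpace.toDual ℝ H).surjective L
  have hperp : (Submodule.span ℝ (Set.range v))ᗮ = ⊥ := by
    rw [Submodule.eq_bot_iff]
    intro x hx
    refine htot x fun j => ?_
    exact Submodule.inner_left_of_mem_orthogonal (Submodule.subset_span (Set.mem_range_self j)) hx
  let B := HilbertBasis.mkOfOrthogonalEqBot hv hperp
  have hB : ∀ j, B j = v j := fun j =>
    congrFun (HilbertBasis.coe_mkOfOrthogonalEqBot hv hperp) j
  have hs := (B.hasSum_repr z).tendsto_sum_nat
  refine ⟨fun k => ‖z - ∑ j ∈ Finset.range k, B.repr z j • B j‖, ?_, fun k x hx => ?_⟩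
  · simpa using (hs.const_sub z).norm
  · have h0 : ⟪∑ j ∈ Finset.range k, B.repr z j • B j, x⟫ = 0 := by
      rw [sum_inner]
      refine Finset.sum_eq_zero fun j hj => ?_
      rw [inner_smul_left, hB, real_inner_comm, hx j (Finset.mem_range.1 hj), mul_zero]
    have h1 : ⟪z, x⟫ = ⟪z - ∑ j ∈ Finset.range k, B.repr z j • B j, x⟫ := by
      rw [inner_sub_left, h0, sub_zero]
    rw [InnerProductSpace.toDual_apply_apply, h1]
    exact abs_real_inner_le_norm _ _

variable {V : Type*} (S : WeightedGraph V)

lemma mu_pos (x : V) : 0 < S.mu x := S.mumin_pos.trans_le (S.mu_ge x)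

lemma w_nonneg (x y : V) : 0 ≤ S.w x y := by
  by_cases h : S.G.Adj x y
  · exact (S.w_pos x y h).le
  · exact (S.w_eq_zero x y h).ge

/-- Neighbor sets are finite by local finiteness. -/
noncomputable instance fintypeNeighborSet (x : V) : Fintype (S.G.neighborSet x) :=
  (S.locallyFinite x).fintype

lemma tsum_w_mul (x : V) (g : V → ℝ) :
    ∑' y, S.w x y * g y = ∑ y : S.G.neighborSet x, S.w x y * g y := by
  rw [← tsum_fintype (L := .unconditional _)]
  refine (tsum_subtype_eq_of_support_subset (f := fun y => S.w x y * g y) fun y hy => ?_).symm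
  by_contra h
  exact hy (by simp [S.w_eq_zero x y h])

/-- The local components of a function entering the energy density at a vertex: the Laplacian,
the potential term, and the differences along the adjacent edges. -/
abbrev EnergyFiber (x : V) : Type _ :=
  EuclideanSpace ℝ (Option (Option (S.G.neighborSet x)))

/-- The vector of local components of `u` at `x`, whose squared norm is the energy density of `u`
at `x` times `μ(x)`. -/
noncomputable def energyVec (a : ℝ) (Vp : V → ℝ) (x : V) : (V → ℝ) →ₗ[ℝ] S.EnergyFiber x where
  toFun u := WithLp.toLp 2 fun
    | none => √(S.mu x) * S.lap u x
    | some none => √(Vp x * S.mu x) * u x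
    | some (some y) => √(a * S.w x y / 2) * (u y - u x)
  map_add' u v := by
    ext o
    rcases o with _ | _ | y
    · simp only [lap, tsum_w_mul, PiLp.add_apply, ← mul_add, ← Finset.sum_add_distrib, Pi.add_apply]
      congr! 3
      ring
    · simp [mul_add]
    · simp only [PiLp.add_apply, Pi.add_apply]
      ring
  map_smul' c u := by
    ext o
    rcases o with _ | _ | y
    · simp only [lap, tsum_w_mul, PiLp.smul_apply, Pi.smul_apply, smul_eq_mul, RingHom.id_apply,
        Finset.mul_sum]
      congr! 1
      ring
    · simp only [PiLp.smul_apply, Pi.smul_apply, smul_eq_mul, RingHom.id_apply]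
      ring
    · simp only [PiLp.smul_apply, Pi.smul_apply, smul_eq_mul, RingHom.id_apply]
      ring

lemma continuous_energyVec (a : ℝ) (Vp : V → ℝ) (x : V) : Continuous (S.energyVec a Vp x) := by
  refine (PiLp.continuous_toLp 2 _).comp (continuous_pi fun o => ?_)
  rcases o with _ | _ | y
  · simp only [lap, tsum_w_mul]
    fun_prop
  · fun_prop
  · fun_prop

variable {a : ℝ} {Vp : V → ℝ}

lemma inner_energyVec (ha : 0 ≤ a) (hVp : ∀ x, 0 ≤ Vp x) (u v : V → ℝ) (x : V) :
    ⟪S.energyVec a Vp x u, S.energyVec a Vp x v⟫ =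
      (S.lap u x * S.lap v x + a * S.gradDot u v x + Vp x * u x * v x) * S.mu x := by
  have hμ := S.mu_pos x
  have h1 : √(S.mu x) * √(S.mu x) = S.mu x := Real.mul_self_sqrt hμ.le
  have h2 : √(Vp x * S.mu x) * √(Vp x * S.mu x) = Vp x * S.mu x :=
    Real.mul_self_sqrt (mul_nonneg (hVp x) hμ.le)
  have h3 : ∀ y, √(a * S.w x y / 2) * √(a * S.w x y / 2) = a * S.w x y / 2 := fun y =>
    Real.mul_self_sqrt (by have := mul_nonneg ha (S.w_nonneg x y); positivity)
  have h4 : a * S.gradDot u v x * S.mu x =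
      ∑ y : S.G.neighborSet x, (a * S.w x y / 2) * ((u y - u x) * (v y - v x)) := by
    simp only [gradDot, mul_assoc]
    rw [S.tsum_w_mul x fun y => (u y - u x) * (v y - v x)]
    simp only [Finset.mul_sum, Finset.sum_mul]
    refine Finset.sum_congr rfl fun y _ => ?_
    field_simp
  have h5 : ∀ y : S.G.neighborSet x,
      (√(a * S.w x y / 2) * (v y - v x)) * (√(a * S.w x y / 2) * (u y - u x)) =
        (a * S.w x y / 2) * ((u y - u x) * (v y - v x)) := fun y => by
    linear_combination ((u y - u x) * (v y - v x)) * h3 y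
  rw [add_mul, add_mul, h4]
  simp only [energyVec, LinearMap.coe_mk, AddHom.coe_mk, PiLp.inner_apply, Fintype.sum_option,
    RCLike.inner_apply, conj_trivial, h5]
  linear_combination (S.lap v x * S.lap u x) * h1 + (v x * u x) * h2

lemma energyDensity_mul_mu (ha : 0 ≤ a) (hVp : ∀ x, 0 ≤ Vp x) (u : V → ℝ) (x : V) :
    S.energyDensity a Vp u x * S.mu x = ‖S.energyVec a Vp x u‖ ^ 2 := by
  have h : S.gradSq u x = S.gradDot u u x := by simp only [gradSq, gradDot, sq, mul_assoc]
  rw [← real_inner_self_eq_norm_sq, S.inner_energyVec ha hVp, energyDensity, h]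
  ring

/-- The image of the energy space in the `ℓ²` sum of the local component spaces. -/
noncomputable def energySubmodule (a : ℝ) (Vp : V → ℝ) : Submodule ℝ (lp S.EnergyFiber 2) where
  carrier := {f | ∃ u : V → ℝ, ∀ x, f x = S.energyVec a Vp x u}
  add_mem' := by
    rintro f g ⟨u, hu⟩ ⟨v, hv⟩
    exact ⟨u + v, fun x => by simp [hu, hv]⟩
  zero_mem' := ⟨0, fun x => by simp⟩
  smul_mem' := by
    rintro c f ⟨u, hu⟩
    exact ⟨c • u, fun x => by simp [hu]⟩

lemma isClosed_energySubmodule (hVp : ∀ x, 0 < Vp x) :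
    IsClosed (S.energySubmodule a Vp : Set (lp S.EnergyFiber 2)) := by
  refine isClosed_of_closure_subset fun f hf => ?_
  obtain ⟨g, hg, hgf⟩ := mem_closure_iff_seq_limit.1 hf
  choose u hu using hg
  have hcoord : ∀ x, Tendsto (fun n => g n x) atTop (𝓝 (f x)) := fun x =>
    ((lp.evalCLM ℝ S.EnergyFiber 2 x).continuous.tendsto f).comp hgf
  let u' : V → ℝ := fun x => (√(Vp x * S.mu x))⁻¹ * f x (some none)
  have hlim : Tendsto u atTop (𝓝 u') := by
    refine tendsto_pi_nhds.2 fun x => ?_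
    have h := ((EuclideanSpace.proj (𝕜 := ℝ) (some none)).continuous.tendsto (f x)).comp (hcoord x)
    refine (h.const_mul (√(Vp x * S.mu x))⁻¹).congr fun n => ?_
    have hpos : 0 < √(Vp x * S.mu x) := Real.sqrt_pos.2 (mul_pos (hVp x) (S.mu_pos x))
    simp only [Function.comp_apply, hu]
    change (√(Vp x * S.mu x))⁻¹ * (√(Vp x * S.mu x) * u n x) = u n x
    rw [inv_mul_cancel_left₀ hpos.ne']
  refine ⟨u', fun x => tendsto_nhds_unique (hcoord x) ?_⟩
  simp only [hu]
  exact ((S.continuous_energyVec a Vp x).tendsto u').comp hlim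

/-- The element of `energySubmodule` associated with a function of finite energy. -/
noncomputable def toEnergy (ha : 0 ≤ a) (hVp : ∀ x, 0 ≤ Vp x) {u : V → ℝ} (hu : S.memE a Vp u) :
    S.energySubmodule a Vp :=
  ⟨⟨fun x => S.energyVec a Vp x u, memℓp_gen <| by
    simpa [memE, S.energyDensity_mul_mu ha hVp] using hu⟩, u, fun _ => rfl⟩

lemma inner_toEnergy (ha : 0 ≤ a) (hVp : ∀ x, 0 ≤ Vp x) {u v : V → ℝ} (hu : S.memE a Vp u)
    (hv : S.memE a Vp v) :
    ⟪S.toEnergy ha hVp hu, S.toEnergy ha hVp hv⟫ = S.innerE a Vp u v := by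
  rw [Submodule.coe_inner, lp.inner_eq_tsum]
  exact tsum_congr fun x => S.inner_energyVec ha hVp u v x

lemma integral_energyDensity (ha : 0 ≤ a) (hVp : ∀ x, 0 ≤ Vp x) {u : V → ℝ}
    (hu : S.memE a Vp u) :
    S.integral (S.energyDensity a Vp u) = ‖S.toEnergy ha hVp hu‖ ^ 2 := by
  rw [← real_inner_self_eq_norm_sq, Submodule.coe_inner, lp.inner_eq_tsum]
  refine tsum_congr fun x => ?_
  rw [S.energyDensity_mul_mu ha hVp]
  exact (real_inner_self_eq_norm_sq _).symm

lemma exists_toEnergy_eq (ha : 0 ≤ a) (hVp : ∀ x, 0 ≤ Vp x) (f : S.energySubmodule a Vp) :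
    ∃ (u : V → ℝ) (hu : S.memE a Vp u), S.toEnergy ha hVp hu = f := by
  obtain ⟨f, u, hfu⟩ := f
  have hu : S.memE a Vp u := by
    have h := (lp.memℓp f).summable (by norm_num)
    simpa [memE, S.energyDensity_mul_mu ha hVp, hfu] using h
  refine ⟨u, hu, Subtype.ext (lp.ext (funext fun x => ?_))⟩
  exact (hfu x).symm

/-- Evaluation at a vertex is small on the tails of an orthonormal basis of the energy space. -/
lemma exists_eval_tail_bound (ha : 0 ≤ a) (hVp : ∀ x, 0 < Vp x) {e : ℕ → V → ℝ}
    (hmem : ∀ j, S.memE a Vp (e j))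
    (hon : ∀ i j, S.innerE a Vp (e i) (e j) = if i = j then 1 else 0)
    (htot : ∀ u : V → ℝ, S.memE a Vp u → (∀ j, S.innerE a Vp u (e j) = 0) → u = 0) (x : V) :
    ∃ β : ℕ → ℝ, Tendsto β atTop (𝓝 0) ∧ ∀ k u, S.memE a Vp u →
      (∀ j < k, S.innerE a Vp u (e j) = 0) →
      (u x) ^ 2 ≤ β k * S.integral (S.energyDensity a Vp u) := by
  have hVp' : ∀ x, 0 ≤ Vp x := fun x => (hVp x).le
  have : CompleteSpace (S.energySubmodule a Vp) :=
    (S.isClosed_energySubmodule hVp).completeSpace_coe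
  have hv : Orthonormal ℝ fun j => S.toEnergy ha hVp' (hmem j) := by
    rw [orthonormal_iff_ite]
    intro i j
    rw [S.inner_toEnergy, hon]
  let L : S.energySubmodule a Vp →L[ℝ] ℝ :=
    (√(Vp x * S.mu x))⁻¹ • ((EuclideanSpace.proj (𝕜 := ℝ) (some none)).comp
      ((lp.evalCLM ℝ S.EnergyFiber 2 x).comp (S.energySubmodule a Vp).subtypeL))
  have hL : ∀ u (hu : S.memE a Vp u), L (S.toEnergy ha hVp' hu) = u x := fun u hu => by
    have hpos : 0 < √(Vp x * S.mu x) := Real.sqrt_pos.2 (mul_pos (hVp x) (S.mu_pos x))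
    change (√(Vp x * S.mu x))⁻¹ * (√(Vp x * S.mu x) * u x) = u x
    rw [inv_mul_cancel_left₀ hpos.ne']
  obtain ⟨β, hβ, hb⟩ := exists_tail_bound hv (fun f hf => by
    obtain ⟨u, hu, rfl⟩ := S.exists_toEnergy_eq ha hVp' f
    have h0 := htot u hu fun j => by rw [← S.inner_toEnergy ha hVp' hu (hmem j)]; exact hf j
    subst h0
    refine Subtype.ext (lp.ext (funext fun x => ?_))
    exact map_zero (S.energyVec a Vp x)) L
  refine ⟨fun k => β k ^ 2, by simpa using hβ.pow 2, fun k u hu ho => ?_⟩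
  have h := hb k (S.toEnergy ha hVp' hu) fun j hj => by
    rw [S.inner_toEnergy]; exact ho j hj
  rw [hL] at h
  rw [S.integral_energyDensity ha hVp' hu, ← mul_pow, ← sq_abs]
  exact pow_le_pow_left₀ (abs_nonneg _) h 2

lemma gradSq_nonneg (u : V → ℝ) (x : V) : 0 ≤ S.gradSq u x := by
  have := S.mu_pos x
  exact mul_nonneg (by positivity)
    (tsum_nonneg fun y => mul_nonneg (S.w_nonneg x y) (sq_nonneg _))

lemma integral_energyDensity_nonneg (ha : 0 ≤ a) (hVp : ∀ x, 0 ≤ Vp x) (u : V → ℝ) :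
    0 ≤ S.integral (S.energyDensity a Vp u) :=
  tsum_nonneg fun x => by rw [S.energyDensity_mul_mu ha hVp]; positivity

lemma sq_apply_le (ha : 0 ≤ a) {θ : ℝ} (hθ : 0 < θ) (hVp : ∀ x, θ ≤ Vp x) {u : V → ℝ}
    (hu : S.memE a Vp u) (x : V) :
    (u x) ^ 2 ≤ (S.mumin * θ)⁻¹ * S.integral (S.energyDensity a Vp u) := by
  have hVp' : ∀ x, 0 ≤ Vp x := fun x => hθ.le.trans (hVp x)
  have hμ := S.mumin_pos
  rw [← div_eq_inv_mul, le_div_iff₀ (by positivity)]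
  have h1 : S.energyDensity a Vp u x * S.mu x ≤ S.integral (S.energyDensity a Vp u) :=
    hu.le_tsum x fun y _ => by rw [S.energyDensity_mul_mu ha hVp']; positivity
  refine le_trans ?_ h1
  have h2 : θ * (u x) ^ 2 ≤ S.energyDensity a Vp u x := by
    have h3 := mul_nonneg ha (S.gradSq_nonneg u x)
    have h4 := mul_le_mul_of_nonneg_right (hVp x) (sq_nonneg (u x))
    have h5 := sq_nonneg (S.lap u x)
    unfold energyDensity
    linarith
  calc (u x) ^ 2 * (S.mumin * θ) = (θ * (u x) ^ 2) * S.mumin := by ring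
    _ ≤ _ := mul_le_mul h2 (S.mu_ge x) hμ.le
      (le_trans (mul_nonneg hθ.le (sq_nonneg _)) h2)

/-- The compactness of the embedding of the energy space into a weighted `ℓ²` space with
summable weight `c`, expressed on the tails of an orthonormal basis. -/
lemma exists_weighted_tail_bound (ha : 0 ≤ a) {θ : ℝ} (hθ : 0 < θ) (hVp : ∀ x, θ ≤ Vp x)
    {e : ℕ → V → ℝ} (hmem : ∀ j, S.memE a Vp (e j))
    (hon : ∀ i j, S.innerE a Vp (e i) (e j) = if i = j then 1 else 0)
    (htot : ∀ u : V → ℝ, S.memE a Vp u → (∀ j, S.innerE a Vp u (e j) = 0) → u = 0)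
    {c : V → ℝ} (hc0 : ∀ x, 0 ≤ c x) (hc : Summable c) {ε : ℝ} (hε : 0 < ε) :
    ∃ K : ℕ, ∀ k, K ≤ k → ∀ u, S.memE a Vp u → (∀ j < k, S.innerE a Vp u (e j) = 0) →
      Summable (fun x => c x * (u x) ^ 2) ∧
      ∑' x, c x * (u x) ^ 2 ≤ ε * S.integral (S.energyDensity a Vp u) := by
  choose β hβ hb using
    S.exists_eval_tail_bound ha (fun x => hθ.trans_le (hVp x)) hmem hon htot
  set Γ := (S.mumin * θ)⁻¹
  have hΓ : 0 ≤ Γ := by have := S.mumin_pos; positivity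
  have hbound : ∀ k x, ‖c x * min |β x k| Γ‖ ≤ c x * Γ := fun k x => by
    rw [Real.norm_eq_abs, abs_of_nonneg (mul_nonneg (hc0 x) (le_min (abs_nonneg _) hΓ))]
    exact mul_le_mul_of_nonneg_left (min_le_right _ _) (hc0 x)
  have hlim : Tendsto (fun k => ∑' x, c x * min |β x k| Γ) atTop (𝓝 (∑' _ : V, (0 : ℝ))) :=
    tendsto_tsum_of_dominated_convergence (hc.mul_right Γ)
      (fun x => by simpa [hΓ] using ((hβ x).abs.min (tendsto_const_nhds (x := Γ))).const_mul (c x))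
      (Eventually.of_forall hbound)
  rw [tsum_zero] at hlim
  obtain ⟨K, hK⟩ := eventually_atTop.1 (hlim.eventually (gt_mem_nhds hε))
  refine ⟨K, fun k hk u hu ho => ?_⟩
  set N := S.integral (S.energyDensity a Vp u)
  have hN : 0 ≤ N := S.integral_energyDensity_nonneg ha (fun x => hθ.le.trans (hVp x)) u
  have hle : ∀ x, c x * (u x) ^ 2 ≤ c x * min |β x k| Γ * N := fun x => by
    rw [mul_assoc]
    refine mul_le_mul_of_nonneg_left ?_ (hc0 x)
    rw [min_mul_of_nonneg _ _ hN]
    exact le_min ((hb x k u hu ho).trans (mul_le_mul_of_nonneg_right (le_abs_self _) hN))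
      (S.sq_apply_le ha hθ hVp hu x)
  have hsum : Summable fun x => c x * min |β x k| Γ * N :=
    (Summable.of_norm_bounded (hc.mul_right Γ) (hbound k)).mul_right N
  have hs := Summable.of_nonneg_of_le (fun x => mul_nonneg (hc0 x) (sq_nonneg (u x))) hle hsum
  refine ⟨hs, (hs.tsum_le_tsum hle hsum).trans ?_⟩
  rw [tsum_mul_right]
  exact mul_le_mul_of_nonneg_right (hK k hk).le hN

/-- Under a quadratic limit at the origin, `a(r) ≤ C r²` for small `r > 0`. -/
lemma CondC1.exists_bound {a : ℝ → ℝ} (h : CondC1 a) :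
    ∃ C δ : ℝ, 0 < C ∧ 0 < δ ∧ ∀ r, 0 < r → r < δ → a r ≤ C * r ^ 2 := by
  obtain ⟨l, hl⟩ := h
  have h1 := hl.eventually (gt_mem_nhds (show l < |l| + 1 by linarith [le_abs_self l]))
  obtain ⟨δ, hδ, hsub⟩ := mem_nhdsGT_iff_exists_Ioo_subset.1 h1
  refine ⟨|l| + 1, δ, by positivity, hδ, fun r hr hrδ => ?_⟩
  have h2 : a r / r ^ 2 < |l| + 1 := hsub ⟨hr, hrδ⟩
  exact ((div_lt_iff₀ (by positivity)).1 h2).le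

end WeightedGraph

/-- Lemma 3.7: under (V), (F₀), (F₁), (C₁), for every sufficiently large `k` there are
`ρ, α > 0` with `Φ ≥ α` on the sphere `∂B_ρ ∩ Z_k`. -/
theorem mountain_pass_geometry_C1
    {V : Type*} (S : WeightedGraph V)
    (a₁ a₂ b₁ b₂ : ℝ) (ha₁ : 0 < a₁) (ha₂ : 0 < a₂) (hb₁ : 0 ≤ b₁) (hb₂ : 0 ≤ b₂)
    (V₁ V₂ : V → ℝ) (θ₁ θ₂ : ℝ) (hV : S.CondV V₁ V₂ θ₁ θ₂)
    (F Fs Ft : V → ℝ → ℝ → ℝ) (hFder : IsPartialDerivs F Fs Ft)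
    (a : ℝ → ℝ) (b : V → ℝ)
    (hF0 : CondF0 F) (hF1 : S.CondF1 F Fs Ft a b) (hC1 : CondC1 a)
    (e₁ e₂ : ℕ → V → ℝ)
    (he₁mem : ∀ j, S.memE a₁ V₁ (e₁ j)) (he₂mem : ∀ j, S.memE a₂ V₂ (e₂ j))
    (he₁on : ∀ i j, S.innerE a₁ V₁ (e₁ i) (e₁ j) = if i = j then 1 else 0)
    (he₂on : ∀ i j, S.innerE a₂ V₂ (e₂ i) (e₂ j) = if i = j then 1 else 0)
    (he₁tot : ∀ u : V → ℝ, S.memE a₁ V₁ u → (∀ j, S.innerE a₁ V₁ u (e₁ j) = 0) → u = 0)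
    (he₂tot : ∀ u : V → ℝ, S.memE a₂ V₂ u → (∀ j, S.innerE a₂ V₂ u (e₂ j) = 0) → u = 0) :
    ∃ K : ℕ, ∀ k, K ≤ k → ∃ ρ α : ℝ, 0 < ρ ∧ 0 < α ∧
      ∀ u v : V → ℝ, S.memE a₁ V₁ u → S.memE a₂ V₂ v →
        (∀ j < k, S.innerE a₁ V₁ u (e₁ j) = 0) →
        (∀ j < k, S.innerE a₂ V₂ v (e₂ j) = 0) →
        S.normE a₁ V₁ u + S.normE a₂ V₂ v = ρ →
        α ≤ S.Phi a₁ a₂ b₁ b₂ V₁ V₂ F u v := by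
  obtain ⟨hg₁, hg₂, hθ₁, hθ₂, -⟩ := hV
  have hV₁ : ∀ x, θ₁ ≤ V₁ x := fun x => hg₁.1 ⟨x, rfl⟩
  have hV₂ : ∀ x, θ₂ ≤ V₂ x := fun x => hg₂.1 ⟨x, rfl⟩
  obtain ⟨-, -, hbpos, hbsum, hFle⟩ := hF1
  obtain ⟨C, δ, hC, hδ, haC⟩ := hC1.exists_bound
  have hc0 : ∀ x, 0 ≤ b x * S.mu x := fun x => (mul_pos (hbpos x) (S.mu_pos x)).le
  have hε : 0 < 1 / (4 * C) := by positivity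
  obtain ⟨K₁, hK₁⟩ := S.exists_weighted_tail_bound ha₁.le hθ₁ hV₁ he₁mem he₁on he₁tot hc0 hbsum hε
  obtain ⟨K₂, hK₂⟩ := S.exists_weighted_tail_bound ha₂.le hθ₂ hV₂ he₂mem he₂on he₂tot hc0 hbsum hε
  have hμ := S.mumin_pos
  set Γ₁ := (S.mumin * θ₁)⁻¹
  set Γ₂ := (S.mumin * θ₂)⁻¹
  have hΓ₁pos : 0 < Γ₁ := by positivity
  have hΓ₂pos : 0 < Γ₂ := by positivity
  have hρ : 0 < δ / (1 + Γ₁ + Γ₂) := by positivity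
  refine ⟨max K₁ K₂, fun k hk => ⟨δ / (1 + Γ₁ + Γ₂), (δ / (1 + Γ₁ + Γ₂)) ^ 2 / 8, hρ,
    by positivity, fun u v hu hv hou hov hnorm => ?_⟩⟩
  obtain ⟨hsu, hsu'⟩ := hK₁ k ((le_max_left _ _).trans hk) u hu hou
  obtain ⟨hsv, hsv'⟩ := hK₂ k ((le_max_right _ _).trans hk) v hv hov
  have hu_sup := S.sq_apply_le ha₁.le hθ₁ hV₁ hu
  have hv_sup := S.sq_apply_le ha₂.le hθ₂ hV₂ hv
  have hN₁ := S.integral_energyDensity_nonneg ha₁.le (fun x => hθ₁.le.trans (hV₁ x)) u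
  have hN₂ := S.integral_energyDensity_nonneg ha₂.le (fun x => hθ₂.le.trans (hV₂ x)) v
  have hn₁ : S.normE a₁ V₁ u ^ 2 = S.integral (S.energyDensity a₁ V₁ u) := Real.sq_sqrt hN₁
  have hn₂ : S.normE a₂ V₂ v ^ 2 = S.integral (S.energyDensity a₂ V₂ v) := Real.sq_sqrt hN₂
  have hn₁0 : 0 ≤ S.normE a₁ V₁ u := Real.sqrt_nonneg _
  have hn₂0 : 0 ≤ S.normE a₂ V₂ v := Real.sqrt_nonneg _
  unfold Phi
  rw [← hn₁] at hu_sup hsu' ⊢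
  rw [← hn₂] at hv_sup hsv' ⊢
  set n₁ := S.normE a₁ V₁ u
  set n₂ := S.normE a₂ V₂ v
  set ρ := δ / (1 + Γ₁ + Γ₂) with hρdef
  have hδρ : δ = (1 + Γ₁ + Γ₂) * ρ := by rw [hρdef]; field_simp
  have hsmall : ∀ x, √(u x ^ 2 + v x ^ 2) < δ := fun x => by
    rw [Real.sqrt_lt' hδ]
    have h1 : Γ₁ * n₁ ^ 2 ≤ Γ₁ * ρ ^ 2 := by gcongr; linarith
    have h2 : Γ₂ * n₂ ^ 2 ≤ Γ₂ * ρ ^ 2 := by gcongr; linarith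
    have h3 : (Γ₁ + Γ₂) * ρ ^ 2 < (1 + Γ₁ + Γ₂) ^ 2 * ρ ^ 2 := by
      gcongr
      nlinarith
    rw [hδρ, mul_pow]
    linarith [hu_sup x, hv_sup x]
  have hFpt : ∀ x, |F x (u x) (v x) * S.mu x| ≤
      C * (b x * S.mu x * u x ^ 2 + b x * S.mu x * v x ^ 2) := fun x => by
    rw [abs_mul, abs_of_pos (S.mu_pos x)]
    have hFb : |F x (u x) (v x)| ≤ C * (u x ^ 2 + v x ^ 2) * b x := by
      rcases (Real.sqrt_nonneg (u x ^ 2 + v x ^ 2)).eq_or_lt with h0 | h0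
      · have h1 : u x ^ 2 + v x ^ 2 = 0 := (Real.sqrt_eq_zero (by positivity)).1 h0.symm
        have hux : u x = 0 := by nlinarith [sq_nonneg (u x), sq_nonneg (v x)]
        have hvx : v x = 0 := by nlinarith [sq_nonneg (u x), sq_nonneg (v x)]
        simp [hux, hvx, hF0.1 x]
      · refine (hFle x (u x) (v x)).2.2.trans ?_
        have h1 := haC _ h0 (hsmall x)
        rw [Real.sq_sqrt (by positivity)] at h1
        exact mul_le_mul_of_nonneg_right h1 (hbpos x).le
    calc |F x (u x) (v x)| * S.mu x ≤ C * (u x ^ 2 + v x ^ 2) * b x * S.mu x :=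
          mul_le_mul_of_nonneg_right hFb (S.mu_pos x).le
      _ = _ := by ring
  have hsum := (hsu.add hsv).mul_left C
  have hFint : S.integral (fun x => F x (u x) (v x)) ≤ (1 / 4) * (n₁ ^ 2 + n₂ ^ 2) := by
    have hle := Summable.tsum_le_tsum (fun x => (le_abs_self _).trans (hFpt x))
      (Summable.of_norm_bounded hsum hFpt) hsum
    rw [tsum_mul_left, hsu.tsum_add hsv] at hle
    calc S.integral (fun x => F x (u x) (v x))
        ≤ C * (1 / (4 * C) * n₁ ^ 2 + 1 / (4 * C) * n₂ ^ 2) :=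
          hle.trans (mul_le_mul_of_nonneg_left (add_le_add hsu' hsv') hC.le)
      _ = _ := by field_simp
  have hk₁ : 0 ≤ b₁ / 4 * S.integral (S.gradSq u) ^ 2 := by positivity
  have hk₂ : 0 ≤ b₂ / 4 * S.integral (S.gradSq v) ^ 2 := by positivity
  have hsq : ρ ^ 2 ≤ 2 * (n₁ ^ 2 + n₂ ^ 2) := by
    rw [← hnorm]; nlinarith [sq_nonneg (n₁ - n₂)]
  linarith
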